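/- Weak (matrix-element) form of the anti-Wick integral representation: for all natural numbers n, m and all γ, δ ∈ ℂ, ∫_ℂ α^m · conj(α)^n · exp( conj(γ)·α + conj(α)·δ ) dP(α) equals the m-th complex derivative in u, followed by the n-th complex derivative in v, of the entire function (u,v) ↦ exp(u·v), evaluated at u = conj(γ), v = δ; i.e., it equals iteratedDeriv m (fun u => iteratedDeriv n (fun v => exp(u·v)) δ) (conj γ). (The left side is the exponential-vector matrix element ⟨exp(γ), (∫_ℂ conj(α)^n α^m |exp(α)⟩⟨exp(α)| dP(α)) exp(δ)⟩ and the right side is ⟨exp(γ), a^m (a*)^n exp(δ)⟩, so this expresses 𝒜((α*)^n α^m) = a^m (a*)^n weakly on exponential vectors.) -/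

import Mathlib

open MeasureTheory Complex

/-- The Gaussian probability measure `P` on `ℂ`, the pushforward of the product of two
standard Gaussians on `ℝ` under `(x, y) ↦ (x + i y)/√2`. -/
noncomputable def gaussP : Measure ℂ :=
  Measure.map (fun p : ℝ × ℝ => ((p.1 : ℂ) + (p.2 : ℂ) * Complex.I) / (Real.sqrt 2 : ℂ))
    ((ProbabilityTheory.gaussianReal 0 1).prod (ProbabilityTheory.gaussianReal 0 1))

open ProbabilityTheory

lemma mul_exp_mul_le (r t : ℝ) : t * Real.exp (r * t) ≤ Real.exp ((r + 1) * t) := by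
  have h : t ≤ Real.exp t := by linarith [Real.add_one_le_exp t]
  calc t * Real.exp (r * t) ≤ Real.exp t * Real.exp (r * t) := by gcongr
    _ = Real.exp ((r + 1) * t) := by rw [← Real.exp_add]; ring_nf

lemma norm_cexp_mul_le {r : ℝ} {z : ℂ} (hz : ‖z‖ ≤ r) (w : ℂ) :
    ‖cexp (z * w)‖ ≤ Real.exp (r * ‖w‖) := by
  rw [Complex.norm_exp, Real.exp_le_exp]
  calc (z * w).re ≤ ‖z * w‖ := Complex.re_le_norm _
    _ = ‖z‖ * ‖w‖ := norm_mul _ _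
    _ ≤ r * ‖w‖ := by gcongr

section Laplace

variable {Ω : Type*} [MeasurableSpace Ω] {μ : Measure Ω} {h X : Ω → ℂ}

lemma integrable_norm_mul_mul_exp (hh : AEStronglyMeasurable h μ) (hX : AEStronglyMeasurable X μ)
    (hexp : ∀ r : ℝ, Integrable (fun ω => ‖h ω‖ * Real.exp (r * ‖X ω‖)) μ) (r : ℝ) :
    Integrable (fun ω => ‖h ω * X ω‖ * Real.exp (r * ‖X ω‖)) μ := by
  refine (hexp (r + 1)).mono' (by fun_prop) (.of_forall fun ω => ?_)
  rw [Real.norm_of_nonneg (by positivity), norm_mul, mul_assoc]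
  gcongr
  exact mul_exp_mul_le r ‖X ω‖

/-- Differentiation under the integral sign for `z ↦ ∫ h * exp (z * X)`, when `h` is integrable
against every `exp (r * ‖X‖)`. -/
lemma hasDerivAt_integral_mul_cexp (hh : AEStronglyMeasurable h μ)
    (hX : AEStronglyMeasurable X μ)
    (hexp : ∀ r : ℝ, Integrable (fun ω => ‖h ω‖ * Real.exp (r * ‖X ω‖)) μ) (z : ℂ) :
    HasDerivAt (fun z => ∫ ω, h ω * cexp (z * X ω) ∂μ)
      (∫ ω, h ω * X ω * cexp (z * X ω) ∂μ) z := by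
  refine (hasDerivAt_integral_of_dominated_loc_of_deriv_le
    (bound := fun ω => ‖h ω * X ω‖ * Real.exp ((‖z‖ + 1) * ‖X ω‖))
    (F := fun z ω => h ω * cexp (z * X ω)) (F' := fun z ω => h ω * X ω * cexp (z * X ω))
    (Metric.ball_mem_nhds z one_pos) (.of_forall fun w => ?_) ?_ ?_
    (.of_forall fun ω w hw => ?_) (integrable_norm_mul_mul_exp hh hX hexp _)
    (.of_forall fun ω w _ => ?_)).2
  · exact hh.mul (Complex.continuous_exp.comp_aestronglyMeasurable (hX.const_mul w))
  · refine (hexp ‖z‖).mono'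
      (hh.mul (Complex.continuous_exp.comp_aestronglyMeasurable (hX.const_mul z)))
      (.of_forall fun ω => ?_)
    rw [norm_mul]
    gcongr
    exact norm_cexp_mul_le le_rfl _
  · exact (hh.mul hX).mul (Complex.continuous_exp.comp_aestronglyMeasurable (hX.const_mul z))
  · rw [norm_mul]
    gcongr
    refine norm_cexp_mul_le ?_ _
    have h₁ := norm_le_norm_add_norm_sub z w
    rw [← dist_eq_norm, dist_comm] at h₁
    linarith [Metric.mem_ball.1 hw]
  · have h₁ := (((hasDerivAt_id w).mul_const (X ω)).cexp).const_mul (h ω)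
    refine h₁.congr_deriv ?_
    simp only [id]
    ring

lemma iteratedDeriv_integral_mul_cexp (k : ℕ) (hh : AEStronglyMeasurable h μ)
    (hX : AEStronglyMeasurable X μ)
    (hexp : ∀ r : ℝ, Integrable (fun ω => ‖h ω‖ * Real.exp (r * ‖X ω‖)) μ) (z : ℂ) :
    iteratedDeriv k (fun z => ∫ ω, h ω * cexp (z * X ω) ∂μ) z
      = ∫ ω, h ω * X ω ^ k * cexp (z * X ω) ∂μ := by
  induction k generalizing h with
  | zero => simp
  | succ k ih =>
    rw [iteratedDeriv_succ',
      funext fun w => (hasDerivAt_integral_mul_cexp hh hX hexp w).deriv,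
      ih (h := fun ω => h ω * X ω) (hh.mul hX) (integrable_norm_mul_mul_exp hh hX hexp)]
    simp only [pow_succ', mul_assoc]

end Laplace

lemma integral_cexp_mul_gaussianReal (z : ℂ) :
    ∫ x : ℝ, cexp (z * x) ∂(gaussianReal 0 1) = cexp (z ^ 2 / 2) := by
  have h := complexMGF_id_gaussianReal (μ := 0) (v := 1) z
  simpa [complexMGF] using h

lemma integrable_exp_mul_norm_gaussP (r : ℝ) :
    Integrable (fun α : ℂ => Real.exp (r * ‖α‖)) gaussP := by
  have hg (s : ℝ) : Integrable (fun x : ℝ => Real.exp (s * |x|)) (gaussianReal 0 1) :=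
    integrable_exp_mul_abs (X := id) (integrable_exp_mul_gaussianReal s)
      (integrable_exp_mul_gaussianReal (-s))
  rw [gaussP, integrable_map_measure (by fun_prop) (by fun_prop)]
  refine ((hg |r|).mul_prod (hg |r|)).mono' (by fun_prop) (.of_forall fun p => ?_)
  rw [Function.comp_apply, Real.norm_of_nonneg (by positivity), ← Real.exp_add,
    Real.exp_le_exp, ← mul_add]
  have h₁ : ‖((p.1 : ℂ) + p.2 * I) / (√2 : ℂ)‖ ≤ |p.1| + |p.2| := by
    rw [norm_div]
    refine (div_le_self (norm_nonneg _) ?_).trans ((norm_add_le _ _).trans ?_)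
    · rw [Complex.norm_of_nonneg (Real.sqrt_nonneg 2)]
      exact Real.one_le_sqrt.2 one_le_two
    · simp
  calc _ ≤ |r| * ‖((p.1 : ℂ) + p.2 * I) / (√2 : ℂ)‖ := by
        gcongr
        exact le_abs_self r
    _ ≤ _ := by gcongr

lemma integrable_norm_cexp_mul_exp_gaussP {X : ℂ → ℂ} (hX : Continuous X)
    (hXn : ∀ α, ‖X α‖ = ‖α‖) (w : ℂ) (r : ℝ) :
    Integrable (fun α => ‖cexp (w * X α)‖ * Real.exp (r * ‖α‖)) gaussP := by
  refine (integrable_exp_mul_norm_gaussP (‖w‖ + r)).mono' (by fun_prop) (.of_forall fun α => ?_)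
  rw [Real.norm_of_nonneg (by positivity), add_mul, Real.exp_add]
  gcongr
  exact (norm_cexp_mul_le le_rfl _).trans_eq (by rw [hXn])

/-- The generating function of the measure `gaussP`. -/
lemma integral_cexp_gaussP (u v : ℂ) :
    ∫ α, cexp (u * α) * cexp (v * (starRingEnd ℂ) α) ∂gaussP = cexp (u * v) := by
  have hs : ((√2 : ℝ) : ℂ) ^ 2 = 2 := by
    rw [← Complex.ofReal_pow, Real.sq_sqrt zero_le_two, Complex.ofReal_ofNat]
  have hs₀ : ((√2 : ℝ) : ℂ) ≠ 0 := by simp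
  have hfac (p : ℝ × ℝ) :
      cexp (u * (((p.1 : ℂ) + p.2 * I) / (√2 : ℂ))) *
        cexp (v * (starRingEnd ℂ) (((p.1 : ℂ) + p.2 * I) / (√2 : ℂ)))
      = cexp ((u + v) / (√2 : ℂ) * p.1) * cexp ((u - v) * I / (√2 : ℂ) * p.2) := by
    simp only [← Complex.exp_add, map_div₀, map_add, map_mul, Complex.conj_ofReal, Complex.conj_I]
    ring_nf
  rw [gaussP, integral_map (by fun_prop) (by fun_prop), integral_congr_ae (.of_forall hfac),
    integral_prod_mul (fun x : ℝ => cexp ((u + v) / (√2 : ℂ) * x))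
      (fun y : ℝ => cexp ((u - v) * I / (√2 : ℂ) * y)),
    integral_cexp_mul_gaussianReal, integral_cexp_mul_gaussianReal, ← Complex.exp_add]
  congr 1
  rw [div_pow, div_pow, hs, mul_pow, Complex.I_sq]
  ring

/-- Weak (matrix-element) form of the anti-Wick integral representation:
for all `n m : ℕ` and `γ δ : ℂ`,
`∫ α^m conj(α)^n exp(conj(γ)·α + conj(α)·δ) dP(α)` equals the `m`-th complex derivative
in `u` of the `n`-th complex derivative in `v` of `(u,v) ↦ exp(u·v)`, evaluated at
`u = conj(γ)`, `v = δ`.  This expresses `𝒜((α*)ⁿ αᵐ) = aᵐ (a*)ⁿ` weakly on exponential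
vectors. -/
theorem antiWick_weak_matrix_elements (n m : ℕ) (γ δ : ℂ) :
    ∫ α, α ^ m * ((starRingEnd ℂ) α) ^ n *
        Complex.exp ((starRingEnd ℂ) γ * α + (starRingEnd ℂ) α * δ) ∂gaussP
      = iteratedDeriv m
          (fun u : ℂ => iteratedDeriv n (fun v : ℂ => Complex.exp (u * v)) δ)
          ((starRingEnd ℂ) γ) := by
  have hexp_conj (k : ℕ) (r : ℝ) : Integrable
      (fun α => ‖cexp (δ * (starRingEnd ℂ) α) * (starRingEnd ℂ) α ^ k‖ * Real.exp (r * ‖α‖))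
      gaussP := by
    induction k generalizing r with
    | zero =>
      simpa only [pow_zero, mul_one] using
        integrable_norm_cexp_mul_exp_gaussP Complex.continuous_conj Complex.norm_conj δ r
    | succ k ih =>
      have h := integrable_norm_mul_mul_exp (μ := gaussP)
        (h := fun α => cexp (δ * (starRingEnd ℂ) α) * (starRingEnd ℂ) α ^ k)
        (X := fun α => (starRingEnd ℂ) α) (by fun_prop) (by fun_prop)
        (by simpa only [Complex.norm_conj] using ih) r
      simpa only [pow_succ, mul_assoc, Complex.norm_conj] using h
  have hinner (u : ℂ) : iteratedDeriv n (fun v : ℂ => cexp (u * v)) δ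
      = ∫ α, (cexp (δ * (starRingEnd ℂ) α) * (starRingEnd ℂ) α ^ n) * cexp (u * α) ∂gaussP := by
    rw [← funext (integral_cexp_gaussP u), iteratedDeriv_integral_mul_cexp n (by fun_prop) (by fun_prop)
      (by simpa only [Complex.norm_conj, id] using
        integrable_norm_cexp_mul_exp_gaussP continuous_id (fun _ => rfl) u)]
    congr! 2 with α
    ring
  simp_rw [hinner]
  rw [iteratedDeriv_integral_mul_cexp m (by fun_prop) (by fun_prop) (hexp_conj n)]
  congr! 2 with α
  rw [Complex.exp_add, mul_comm _ δ]
  ring
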